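/- arXiv:2605.18644 — 3 statements merged into one kernel-verified Lean document; each statement's English description precedes it below -/
import Mathlib

section
/- If C is a distinct covering system with least modulus 6 whose moduli have least common multiple L = 2^a·3^b·5^c, where a, b, c are positive integers with a ≥ b ≥ c, then a ≥ 4 and b ≥ 2. -/
/-!
Subsets of `{0, …, 215}` are coded by natural numbers, one base-`256` digit for each element. The
definitions below branch over the residue classes of the moduli dividing `216`, and cut a branch
when the uncovered set is too large to be covered by the remaining moduli. They are stated with
recursors and primitive operations on `ℕ` so that the kernel evaluates them quickly.
-/

/-- The maximum of `a` and the `d` lowest base-`256` digits of `m`. -/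
def maxDigit (d : ℕ) : ℕ → ℕ → ℕ :=
  Nat.rec (motive := fun _ ↦ ℕ → ℕ → ℕ) (fun _ a ↦ a)
    (fun _ ih m a ↦ cond (Nat.ble (Nat.mod m 256) a) (ih (Nat.div m 256) a)
      (ih (Nat.div m 256) (Nat.mod m 256))) d

/-- An upper bound for the size of the largest residue class mod `d` in the set coded by `m`. -/
def classBound (d m : ℕ) : ℕ :=
  cond (Nat.ble d 18) (maxDigit d (Nat.mod m (Nat.sub (Nat.pow 256 d) 1)) 0) (Nat.div 216 d)

/-- The code of the residue class of `c` mod `d`, for `d ∣ 216` and `c < d`. -/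
def classCode (d c : ℕ) : ℕ :=
  Nat.mul (Nat.pow 256 c)
    (Nat.div (Nat.sub (Nat.pow 256 216) 1) (Nat.sub (Nat.pow 256 d) 1))

/-- The divisors of `216` other than `1`. -/
def properDivisors216 : List ℕ := [2, 3, 4, 6, 8, 9, 12, 18, 24, 27, 36, 54, 72, 108, 216]

/-- The sum of `classBound d m` over `d` in `l`. -/
def classBoundSum (m : ℕ) (l : List ℕ) : ℕ :=
  List.rec 0 (fun d _ ih ↦ Nat.add (classBound d m) ih) l

/-- Whether the moduli in `l`, together with the divisors of `27000` that are divisible by `5` and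
greater than `5`, are too sparse to cover the residues mod `27000` that lie over the set coded
by `m`. For `d ∣ 216` with `d > 1`, the moduli `5 * d`, `25 * d`, `125 * d` contribute
`(25 + 5 + 1) * classBound d m`, and `25`, `125` contribute `5 + 1` times the size of the set. -/
def tooLight (l : List ℕ) (m : ℕ) : Bool :=
  Nat.blt (Nat.add (Nat.mul 31 (classBoundSum m properDivisors216))
     (Nat.mul 125 (classBoundSum m l))) (Nat.mul 119 (maxDigit 1 (Nat.mod m 255) 0))

/-- Whether `p c` holds for all `c < d`. -/
def allBelow (p : ℕ → Bool) (d : ℕ) : Bool :=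
  Nat.rec true (fun c ih ↦ cond (p c) ih false) d

/-- The code of the set coded by `m` without the residue class of `c` mod `d`. -/
def removeClass (d c m : ℕ) : ℕ := Nat.sub m (Nat.land m (classCode d c))

/-- A search that returns `true` only if the set coded by `m` cannot be covered by one class for each
modulus in `l` and for each divisor of `27000` that is divisible by `5` and greater than `5`.
Classes that miss the set are skipped. -/
def search (l : List ℕ) : ℕ → Bool :=
  List.rec (motive := fun _ ↦ ℕ → Bool) (tooLight [])
    (fun d l ih m ↦ cond (tooLight (d :: l) m) true
      (cond (Nat.beq m 0) false
        (allBelow (fun c ↦ cond (Nat.beq (Nat.land m (classCode d c)) 0) true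
          (ih (removeClass d c m))) d))) l

open Finset

/-- The code of a finite set `s` has base-`256` digit `1` at the places in `s`, and `0` elsewhere. -/
def code (s : Finset ℕ) : ℕ := ∑ x ∈ s, 256 ^ x

theorem maxDigit_succ (d m a : ℕ) :
    maxDigit (d + 1) m a = maxDigit d (m / 256) (max a (m % 256)) := by
  change cond (Nat.ble (m % 256) a) (maxDigit d (m / 256) a) (maxDigit d (m / 256) (m % 256)) = _
  cases h : Nat.ble (m % 256) a
  · have : ¬ m % 256 ≤ a := fun h' ↦ by simp [Nat.ble_eq_true_of_le h'] at h
    rw [max_eq_right (by omega), cond_false]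
  · rw [max_eq_left (Nat.le_of_ble_eq_true h), cond_true]

theorem le_maxDigit (d m a : ℕ) : a ≤ maxDigit d m a := by
  induction d generalizing m a with
  | zero => exact le_rfl
  | succ d ih => rw [maxDigit_succ]; exact (le_max_left _ _).trans (ih _ _)

theorem digit_le_maxDigit {f : ℕ → ℕ} (hf : ∀ i, f i < 256) {d c : ℕ} (hc : c < d) (a : ℕ) :
    f c ≤ maxDigit d (∑ i ∈ range d, f i * 256 ^ i) a := by
  induction d generalizing f c a with
  | zero => omega
  | succ d ih =>
    have h : ∑ i ∈ range (d + 1), f i * 256 ^ i =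
        f 0 + 256 * ∑ i ∈ range d, f (i + 1) * 256 ^ i := by
      rw [sum_range_succ', mul_sum, add_comm]
      simp [pow_succ', mul_left_comm]
    have h0 := hf 0
    rw [maxDigit_succ, h, show (f 0 + 256 * ∑ i ∈ range d, f (i + 1) * 256 ^ i) / 256 =
      ∑ i ∈ range d, f (i + 1) * 256 ^ i by omega,
      show (f 0 + 256 * ∑ i ∈ range d, f (i + 1) * 256 ^ i) % 256 = f 0 by omega]
    cases c with
    | zero => exact (le_max_right _ _).trans (le_maxDigit _ _ _)
    | succ c => exact ih (f := fun i ↦ f (i + 1)) (fun i ↦ hf _) (by omega) _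

theorem sum_digits_lt {f : ℕ → ℕ} (hf : ∀ i, f i < 255) {d : ℕ} (hd : 0 < d) :
    ∑ i ∈ range d, f i * 256 ^ i < 256 ^ d - 1 := by
  induction d, hd using Nat.le_induction with
  | base => simpa using hf 0
  | succ d _ ih =>
    rw [sum_range_succ, pow_succ]
    have := Nat.mul_le_mul_right (256 ^ d) (Nat.le_of_lt_succ (hf d))
    omega

theorem code_mod (s : Finset ℕ) (hs : #s < 255) {d : ℕ} (hd : 0 < d) :
    code s % (256 ^ d - 1) = ∑ c ∈ range d, #{x ∈ s | x % d = c} * 256 ^ c := by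
  rw [← Nat.mod_eq_of_lt (sum_digits_lt
    (fun c ↦ (card_filter_le s fun x ↦ x % d = c).trans_lt hs) hd)]
  change _ ≡ _ [MOD 256 ^ d - 1]
  have h1 : 256 ^ d ≡ 1 [MOD 256 ^ d - 1] :=
    ((Nat.modEq_iff_dvd' (Nat.one_le_pow _ _ (by norm_num))).2 (dvd_refl _)).symm
  have h2 (x : ℕ) : 256 ^ x ≡ 256 ^ (x % d) [MOD 256 ^ d - 1] := by
    conv_lhs => rw [← Nat.mod_add_div x d, pow_add, pow_mul]
    simpa using (h1.pow (x / d)).mul_left (256 ^ (x % d))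
  have h3 : ∑ c ∈ range d, #{x ∈ s | x % d = c} * 256 ^ c = ∑ x ∈ s, 256 ^ (x % d) := by
    rw [← sum_fiberwise_of_maps_to (s := s) (g := fun x ↦ x % d) (t := range d)
      (fun x _ ↦ mem_range.2 (Nat.mod_lt x hd))]
    refine sum_congr rfl fun c _ ↦ ?_
    rw [card_eq_sum_ones, sum_mul]
    exact sum_congr rfl fun x hx ↦ by rw [(mem_filter.1 hx).2, one_mul]
  rw [h3, code]
  exact Nat.ModEq.sum fun x _ ↦ h2 x

theorem card_code (s : Finset ℕ) (hs : #s < 255) : maxDigit 1 (code s % 255) 0 = #s := by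
  have h := code_mod s hs one_pos
  simp only [pow_one, range_one, sum_singleton, Nat.mod_one, filter_true, pow_zero, mul_one] at h
  norm_num at h
  rw [h, maxDigit_succ]
  simp [maxDigit, Nat.mod_eq_of_lt (hs.trans (by norm_num : 255 < 256))]

theorem card_class_le_div {N : ℕ} {s : Finset ℕ} (hs : s ⊆ range N) {d : ℕ} (hd : d ∣ N)
    (c : ℕ) : #{x ∈ s | x % d = c} ≤ N / d := by
  rw [← card_range (N / d)]
  refine card_le_card_of_injOn (fun x ↦ x / d) (fun x hx ↦ ?_) (fun x hx y hy hxy ↦ ?_)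
  · have := mem_range.1 (hs (mem_filter.1 hx).1)
    exact mem_coe.2 (mem_range.2 (Nat.div_lt_div_of_lt_of_dvd hd this))
  · rw [← Nat.mod_add_div x d, ← Nat.mod_add_div y d, (mem_filter.1 hx).2, (mem_filter.1 hy).2]
    simp only at hxy
    rw [hxy]

theorem card_lt_of_subset {s : Finset ℕ} (hs : s ⊆ range 216) : #s < 255 :=
  (card_le_card hs).trans_lt (by simp)

theorem card_class_le {s : Finset ℕ} (hs : s ⊆ range 216) {d : ℕ} (hd : 0 < d)
    (hd' : d ∣ 216) (c : ℕ) : #{x ∈ s | x % d = c % d} ≤ classBound d (code s) := by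
  rw [classBound]
  cases Nat.ble d 18
  · exact card_class_le_div hs hd' _
  · change _ ≤ maxDigit d (code s % (256 ^ d - 1)) 0
    have hs' := card_lt_of_subset hs
    rw [code_mod s hs' hd]
    exact digit_le_maxDigit (f := fun c ↦ #{x ∈ s | x % d = c})
      (fun i ↦ ((card_filter_le _ _).trans_lt hs').trans (by norm_num)) (Nat.mod_lt c hd) 0

theorem testBit_code (s : Finset ℕ) (j : ℕ) : (code s).testBit j ↔ ∃ x ∈ s, 8 * x = j := by
  have h : code s = ∑ i ∈ s.image (8 * ·), 2 ^ i := by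
    rw [sum_image fun x _ y _ h ↦ by simpa using h]
    simp [code, pow_mul]
  rw [← Nat.mem_bitIndices, ← List.mem_toFinset, h, toFinset_bitIndices_sum_two_pow, mem_image]

theorem code_land (s t : Finset ℕ) : Nat.land (code s) (code t) = code (s ∩ t) := by
  change code s &&& code t = _
  refine Nat.eq_of_testBit_eq fun j ↦ Bool.eq_iff_iff.2 ?_
  rw [Nat.testBit_land, Bool.and_eq_true, testBit_code, testBit_code, testBit_code]
  constructor
  · rintro ⟨⟨x, hx, rfl⟩, y, hy, h⟩
    obtain rfl : y = x := by omega
    exact ⟨y, mem_inter.2 ⟨hx, hy⟩, rfl⟩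
  · rintro ⟨x, hx, rfl⟩
    exact ⟨⟨x, (mem_inter.1 hx).1, rfl⟩, x, (mem_inter.1 hx).2, rfl⟩

theorem code_eq_zero {s : Finset ℕ} : code s = 0 ↔ s = ∅ := by
  simp [code, sum_eq_zero_iff, eq_empty_iff_forall_notMem]

theorem classCode_eq {d c : ℕ} (hc : c < d) (hd : d ∣ 216) :
    classCode d c = code {x ∈ range 216 | x % d = c} := by
  obtain ⟨k, hk⟩ := hd
  have h := Nat.geomSum_eq (m := 256 ^ d) (le_self_pow₀ (by norm_num) (by omega) |>.trans' (by norm_num : 2 ≤ 256)) k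
  rw [← pow_mul, ← hk] at h
  change 256 ^ c * ((256 ^ 216 - 1) / (256 ^ d - 1)) = _
  have himage : {x ∈ range 216 | x % d = c} = (range k).image fun i ↦ c + d * i := by
    ext x
    simp only [mem_filter, mem_range, mem_image]
    constructor
    · rintro ⟨hx, rfl⟩
      exact ⟨x / d, Nat.div_lt_of_lt_mul (hk ▸ hx), Nat.mod_add_div x d⟩
    · rintro ⟨i, hi, rfl⟩
      refine ⟨?_, by rw [Nat.add_mul_mod_self_left, Nat.mod_eq_of_lt hc]⟩
      calc c + d * i < d * (i + 1) := by rw [mul_add]; omega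
        _ ≤ 216 := hk ▸ Nat.mul_le_mul_left d hi
  rw [← h, mul_sum, himage, code, sum_image]
  · simp [pow_add, pow_mul]
  · intro x _ y _ h
    have hd : 0 < d := by omega
    exact Nat.eq_of_mul_eq_mul_left hd (by simpa using h)

theorem code_land_classCode {s : Finset ℕ} (hs : s ⊆ range 216) {d c : ℕ} (hc : c < d)
    (hd : d ∣ 216) : Nat.land (code s) (classCode d c) = code {x ∈ s | x % d = c} := by
  rw [classCode_eq hc hd, code_land, inter_filter, inter_eq_left.2 hs]

theorem removeClass_code {s : Finset ℕ} (hs : s ⊆ range 216) {d c : ℕ} (hc : c < d)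
    (hd : d ∣ 216) : removeClass d c (code s) = code {x ∈ s | x % d ≠ c} := by
  rw [removeClass, code_land_classCode hs hc hd]
  change code s - _ = _
  rw [code, ← sum_filter_add_sum_filter_not s fun x ↦ x % d = c]
  exact Nat.add_sub_cancel_left _ _

theorem card_progression_le (s : Finset ℕ) {d q : ℕ} (hd : d ∣ 216) (hq : q ∣ 125) (c : ℕ) :
    #{x ∈ range 27000 | x % 216 ∈ s ∧ x % (d * q) = c % (d * q)} ≤
      125 / q * #{y ∈ s | y % d = c % d} := by
  have hq0 : 0 < q := Nat.pos_of_dvd_of_pos hq (by norm_num)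
  rw [mul_comm (125 / q), ← card_range (125 / q), ← card_product]
  have key {x : ℕ} (hx : x % (d * q) = c % (d * q)) : x % d = c % d ∧ x % q = c % q :=
    ⟨Nat.ModEq.of_mul_right q hx, Nat.ModEq.of_mul_left d hx⟩
  refine card_le_card_of_injOn (fun x ↦ (x % 216, x % 125 / q)) (fun x hx ↦ ?_)
    (fun x hx y hy hxy ↦ ?_)
  · obtain ⟨-, hs, h⟩ := mem_filter.1 hx
    simp only [coe_product, Set.mem_prod, mem_coe, mem_filter, mem_range]
    exact ⟨⟨hs, by rw [Nat.mod_mod_of_dvd _ hd, (key h).1]⟩,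
      Nat.div_lt_div_of_lt_of_dvd hq (Nat.mod_lt x (by norm_num))⟩
  · obtain ⟨hx, -, hx'⟩ := mem_filter.1 hx
    obtain ⟨hy, -, hy'⟩ := mem_filter.1 hy
    obtain ⟨h1, h2⟩ := Prod.mk.inj hxy
    have h3 : x % 125 = y % 125 := by
      rw [← Nat.mod_add_div (x % 125) q, ← Nat.mod_add_div (y % 125) q, h2,
        Nat.mod_mod_of_dvd _ hq, Nat.mod_mod_of_dvd _ hq, (key hx').2, (key hy').2]
    have := mem_range.1 hx
    have := mem_range.1 hy
    omega

theorem card_fibers (s : Finset ℕ) (hs : s ⊆ range 216) :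
    125 * #s ≤ #{x ∈ range 27000 | x % 216 ∈ s} := by
  rw [mul_comm, ← card_range 125, ← card_product]
  refine card_le_card_of_injOn (fun p ↦ p.1 + 216 * p.2) (fun p hp ↦ ?_) (fun p hp q hq h ↦ ?_)
  · obtain ⟨h1, h2⟩ := mem_product.1 hp
    have h3 := mem_range.1 (hs h1)
    have h4 := mem_range.1 h2
    refine mem_filter.2 ⟨mem_range.2 (by dsimp only; omega), ?_⟩
    rwa [Nat.add_mul_mod_self_left, Nat.mod_eq_of_lt h3]
  · have h1 := mem_range.1 (hs (mem_product.1 hp).1)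
    have h2 := mem_range.1 (hs (mem_product.1 hq).1)
    simp only at h
    exact Prod.ext (by omega) (by omega)

theorem card_exists_mem_le (A : Finset ℕ) (P : ℕ → ℕ → Prop) (k m : ℕ) (l : List ℕ)
    (h : ∀ d ∈ l, ∀ B : Finset ℕ, B ⊆ A → (∀ x ∈ B, P d x) → #B ≤ k * classBound d m)
    (B : Finset ℕ) (hB : B ⊆ A) (hP : ∀ x ∈ B, ∃ d ∈ l, P d x) :
    #B ≤ k * classBoundSum m l := by
  classical
  induction l generalizing B with
  | nil =>
    simp [eq_empty_iff_forall_notMem.2 fun x hx ↦ absurd (hP x hx) (by simp)]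
  | cons d l ih =>
    have h1 := h d List.mem_cons_self {x ∈ B | P d x} ((filter_subset _ _).trans hB)
      fun x hx ↦ (mem_filter.1 hx).2
    have h2 := ih (fun d hd ↦ h d (List.mem_cons_of_mem _ hd)) {x ∈ B | ¬ P d x}
      ((filter_subset _ _).trans hB) fun x hx ↦ by
        obtain ⟨hx, hx'⟩ := mem_filter.1 hx
        obtain ⟨e, he, hxe⟩ := hP x hx
        rcases List.mem_cons.1 he with rfl | he
        · exact absurd hxe hx'
        · exact ⟨e, he, hxe⟩
    rw [← card_filter_add_card_filter_not (s := B) (P d)]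
    calc _ ≤ _ := Nat.add_le_add h1 h2
      _ = k * classBoundSum m (d :: l) := (Nat.mul_add _ _ _).symm

/-- The residues `x` mod `27000` with `x % 216 ∈ s` are covered by the classes of `ρ` whose moduli
are in `l` or are divisors of `27000` divisible by `5` and greater than `5`. -/
def Covered (ρ : ℕ → ℕ) (l : List ℕ) (s : Finset ℕ) : Prop :=
  ∀ x < 27000, x % 216 ∈ s → (∃ d ∈ l, x % d = ρ d % d) ∨
    (∃ d ∈ properDivisors216, ∃ q ∈ [5, 25, 125], x % (d * q) = ρ (d * q) % (d * q)) ∨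
    ∃ q ∈ [25, 125], x % q = ρ q % q

theorem properDivisors216_spec {d : ℕ} (hd : d ∈ properDivisors216) : 0 < d ∧ d ∣ 216 := by
  simp only [properDivisors216, List.mem_cons, List.not_mem_nil, or_false] at hd
  rcases hd with rfl | rfl | rfl | rfl | rfl | rfl | rfl | rfl | rfl | rfl | rfl | rfl | rfl |
    rfl | rfl <;> norm_num

/-- Comparing densities: a set that can be covered is not too light. -/
theorem Covered.not_tooLight {ρ : ℕ → ℕ} {l : List ℕ} {s : Finset ℕ} (h : Covered ρ l s)
    (hs : s ⊆ range 216) (hl : ∀ d ∈ l, 0 < d ∧ d ∣ 216) : tooLight l (code s) = false := by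
  classical
  set A := {x ∈ range 27000 | x % 216 ∈ s} with hA
  have hprog {d q : ℕ} (hd : d ∣ 216) (hq : q ∣ 125) (c : ℕ) :
      #{x ∈ A | x % (d * q) = c % (d * q)} ≤ 125 / q * #{y ∈ s | y % d = c % d} := by
    rw [hA, filter_filter]
    exact card_progression_le s hd hq c
  let P (d x : ℕ) : Prop := x % d = ρ d % d
  let Q (d x : ℕ) : Prop := ∃ q ∈ [5, 25, 125], x % (d * q) = ρ (d * q) % (d * q)
  let T (x : ℕ) : Prop := ∃ q ∈ [25, 125], x % q = ρ q % q
  have hP := card_exists_mem_le A P 125 (code s) l (fun d hd B hB hBP ↦ by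
    obtain ⟨hd0, hd⟩ := hl d hd
    have h1 := hprog (q := 1) hd (one_dvd _) (ρ d)
    simp only [mul_one, Nat.div_one] at h1
    exact (card_le_card fun x hx ↦ mem_filter.2 ⟨hB hx, hBP x hx⟩).trans
      (h1.trans (Nat.mul_le_mul_left _ (card_class_le hs hd0 hd _))))
    {x ∈ A | ∃ d ∈ l, P d x} (filter_subset _ _) fun x hx ↦ (mem_filter.1 hx).2
  have hQ := card_exists_mem_le A Q 31 (code s) properDivisors216 (fun d hd B hB hBQ ↦ by
    obtain ⟨hd0, hd⟩ := properDivisors216_spec hd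
    have h1 (q : ℕ) (hq : q ∣ 125) := (hprog hd hq (ρ (d * q))).trans
      (Nat.mul_le_mul_left _ (card_class_le hs hd0 hd _))
    have hB' : B ⊆ {x ∈ A | x % (d * 5) = ρ (d * 5) % (d * 5)} ∪
        ({x ∈ A | x % (d * 25) = ρ (d * 25) % (d * 25)} ∪
        {x ∈ A | x % (d * 125) = ρ (d * 125) % (d * 125)}) := fun x hx ↦ by
      have h2 := hBQ x hx
      simp only [Q, List.mem_cons, List.not_mem_nil, or_false, exists_eq_or_imp,
        exists_eq_left] at h2
      simpa only [mem_union, mem_filter, hB hx, true_and] using h2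
    have h2 := (card_le_card hB').trans ((card_union_le _ _).trans
      (Nat.add_le_add_left (card_union_le _ _) _))
    have h5 := h1 5 (by norm_num)
    have h25 := h1 25 (by norm_num)
    have h125 := h1 125 (by norm_num)
    norm_num at h5 h25 h125
    omega)
    {x ∈ A | ∃ d ∈ properDivisors216, Q d x} (filter_subset _ _) fun x hx ↦ (mem_filter.1 hx).2
  have hT : #{x ∈ A | T x} ≤ 6 * #s := by
    have h1 (q : ℕ) (hq : q ∣ 125) := (hprog (one_dvd _) hq (ρ q)).trans
      (Nat.mul_le_mul_left _ (card_filter_le s _))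
    simp only [one_mul] at h1
    have h2 : #{x ∈ A | T x} ≤
        #({x ∈ A | x % 25 = ρ 25 % 25} ∪ {x ∈ A | x % 125 = ρ 125 % 125}) :=
      card_le_card fun x hx ↦ by
        have h3 := mem_filter.1 hx
        simp only [T, List.mem_cons, List.not_mem_nil, or_false, exists_eq_or_imp,
          exists_eq_left] at h3
        simpa only [mem_union, mem_filter, h3.1, true_and] using h3.2
    have h3 := h2.trans (card_union_le _ _)
    have h25 := h1 25 (by norm_num)
    have h125 := h1 125 (by norm_num)
    norm_num at h25 h125
    omega
  have hcov : A ⊆ {x ∈ A | ∃ d ∈ l, P d x} ∪ ({x ∈ A | ∃ d ∈ properDivisors216, Q d x} ∪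
      {x ∈ A | T x}) := fun x hx ↦ by
    obtain ⟨h1, h2⟩ := mem_filter.1 hx
    simp only [mem_union, mem_filter, hx, true_and]
    exact h x (mem_range.1 h1) h2
  have h1 := (card_le_card hcov).trans ((card_union_le _ _).trans
    (Nat.add_le_add_left (card_union_le _ _) _))
  have h2 : 125 * #s ≤ #A := card_fibers s hs
  refine Bool.eq_false_iff.2 fun h3 ↦ ?_
  rw [tooLight] at h3
  replace h3 := Nat.le_of_ble_eq_true h3
  change 31 * _ + 125 * _ < 119 * maxDigit 1 (code s % 255) 0 at h3
  rw [card_code s (card_lt_of_subset hs)] at h3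
  omega

theorem Covered.mono {ρ : ℕ → ℕ} {l : List ℕ} {s t : Finset ℕ} (h : Covered ρ l t)
    (hst : s ⊆ t) : Covered ρ l s := fun x hx hxs ↦ h x hx (hst hxs)

theorem Covered.of_cons {ρ : ℕ → ℕ} {d : ℕ} {l : List ℕ} {s : Finset ℕ}
    (h : Covered ρ (d :: l) s) (hd : d ∣ 216) : Covered ρ l {x ∈ s | x % d ≠ ρ d % d} := by
  intro x hx hxs
  obtain ⟨hxs, hne⟩ := mem_filter.1 hxs
  rw [Nat.mod_mod_of_dvd _ hd] at hne
  simpa only [List.mem_cons, exists_eq_or_imp, hne, false_or] using h x hx hxs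

theorem allBelow_apply {p : ℕ → Bool} {d : ℕ} (h : allBelow p d = true) {c : ℕ} (hc : c < d) :
    p c = true := by
  induction d with
  | zero => omega
  | succ d ih =>
    change cond (p d) (allBelow p d) false = true at h
    cases hp : p d
    · simp [hp] at h
    · rw [hp, cond_true] at h
      rcases Nat.lt_succ_iff_lt_or_eq.1 hc with hc | rfl
      exacts [ih h hc, hp]

theorem Covered.search_eq_false {ρ : ℕ → ℕ} {l : List ℕ} {s : Finset ℕ} (h : Covered ρ l s)
    (hs : s ⊆ range 216) (hl : ∀ d ∈ l, 0 < d ∧ d ∣ 216) : search l (code s) = false := by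
  induction l generalizing s with
  | nil => exact h.not_tooLight hs hl
  | cons d l ih =>
    obtain ⟨hd0, hd⟩ := hl d List.mem_cons_self
    have hl' : ∀ d ∈ l, 0 < d ∧ d ∣ 216 := fun e he ↦ hl e (List.mem_cons_of_mem _ he)
    change cond (tooLight (d :: l) (code s)) true (cond (Nat.beq (code s) 0) false
      (allBelow (fun c ↦ cond (Nat.beq (Nat.land (code s) (classCode d c)) 0) true
        (search l (removeClass d c (code s)))) d)) = false
    rw [h.not_tooLight hs hl, cond_false]
    cases hbeq : Nat.beq (code s) 0
    · rw [cond_false]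
      refine Bool.eq_false_iff.2 fun hall ↦ ?_
      have key (x : ℕ) (hx : x ∈ s) (hcov : Covered ρ l {y ∈ s | y % d ≠ x % d}) : False := by
        have h1 := allBelow_apply hall (Nat.mod_lt x hd0)
        rw [code_land_classCode hs (Nat.mod_lt x hd0) hd,
          removeClass_code hs (Nat.mod_lt x hd0) hd,
          ih hcov ((filter_subset _ _).trans hs) hl'] at h1
        cases h2 : Nat.beq (code {y ∈ s | y % d = x % d}) 0
        · simp [h2] at h1
        · have h3 := code_eq_zero.1 (Nat.eq_of_beq_eq_true h2)
          exact notMem_empty x (h3 ▸ mem_filter.2 ⟨hx, rfl⟩)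
      have h1 := h.of_cons hd
      by_cases hmeet : ∃ x ∈ s, x % d = ρ d % d
      · obtain ⟨x, hx, hxd⟩ := hmeet
        exact key x hx (hxd ▸ h1)
      · push Not at hmeet
        rw [filter_true_of_mem hmeet] at h1
        obtain ⟨x, hx⟩ : s.Nonempty := by
          rw [nonempty_iff_ne_empty]
          rintro rfl
          simp [code] at hbeq
        exact key x hx (h1.mono (filter_subset _ _))
    · rfl

set_option maxHeartbeats 0 in
theorem search_eq_true : allBelow (fun c ↦ search [9, 12, 18, 24, 36, 72, 54, 108, 216]
    (removeClass 6 c (removeClass 27 0 (removeClass 8 0 (classCode 1 0))))) 4 = true := by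
  decide +kernel

theorem not_covered {ρ : ℕ → ℕ} (h8 : ρ 8 % 8 = 0) (h27 : ρ 27 % 27 = 0) (h6 : ρ 6 % 6 < 4) :
    ¬ Covered ρ [8, 27, 6, 9, 12, 18, 24, 36, 72, 54, 108, 216] (range 216) := by
  intro h
  have h1 := ((h.of_cons (by norm_num)).of_cons (by norm_num)).of_cons (by norm_num)
  rw [h8, h27] at h1
  have hs1 := filter_subset (fun x ↦ x % 8 ≠ 0) (range 216)
  have hs2 := (filter_subset (fun x ↦ x % 27 ≠ 0) _).trans hs1
  have hs3 := (filter_subset (fun x ↦ x % 6 ≠ ρ 6 % 6) _).trans hs2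
  have h2 := h1.search_eq_false hs3 (by simp)
  have h3 := allBelow_apply search_eq_true h6
  have h0 : classCode 1 0 = code (range 216) := by
    rw [classCode_eq one_pos (one_dvd _)]
    simp [Nat.mod_one]
  rw [h0, removeClass_code subset_rfl (by norm_num) (by norm_num),
    removeClass_code hs1 (by norm_num) (by norm_num),
    removeClass_code hs2 (Nat.mod_lt _ (by norm_num)) (by norm_num), h2] at h3
  exact Bool.false_ne_true h3

theorem covered_of_forall_exists {ρ : ℕ → ℕ}
    (h : ∀ x : ℕ, ∃ n, 6 ≤ n ∧ n ∣ 27000 ∧ x % n = ρ n % n) :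
    Covered ρ [8, 27, 6, 9, 12, 18, 24, 36, 72, 54, 108, 216] (range 216) := by
  intro x _ _
  obtain ⟨n, hn6, hn, hx⟩ := h x
  have hcop : Nat.Coprime 216 125 := by norm_num
  obtain ⟨d, q, hd, hq, rfl⟩ : ∃ d q, d ∣ 216 ∧ q ∣ 125 ∧ d * q = n :=
    ⟨_, _, Nat.gcd_dvd_right n 216, Nat.gcd_dvd_right n 125, by
      rw [← hcop.gcd_mul]; exact Nat.gcd_eq_left hn⟩
  have hq' : q ∈ ({1, 5, 25, 125} : Finset ℕ) := by
    rw [show ({1, 5, 25, 125} : Finset ℕ) = Nat.divisors 125 by decide +kernel]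
    exact Nat.mem_divisors.2 ⟨hq, by norm_num⟩
  have hd' : d ∈ (1 :: properDivisors216).toFinset := by
    rw [show (1 :: properDivisors216).toFinset = Nat.divisors 216 by decide +kernel]
    exact Nat.mem_divisors.2 ⟨hd, by norm_num⟩
  rw [List.mem_toFinset, List.mem_cons] at hd'
  simp only [mem_insert, mem_singleton] at hq'
  by_cases hq1 : q = 1
  · subst hq1
    rw [mul_one] at hx hn6
    refine Or.inl ⟨d, ?_, hx⟩
    simp only [properDivisors216, List.mem_cons, List.not_mem_nil, or_false] at hd' ⊢
    omega
  · refine Or.inr ?_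
    rcases hd' with rfl | hd'
    · rw [one_mul] at hx hn6
      exact Or.inr ⟨q, by simp only [List.mem_cons, List.not_mem_nil, or_false]; omega, hx⟩
    · exact Or.inl ⟨d, hd', q, by
        simp only [List.mem_cons, List.not_mem_nil, or_false]; omega, hx⟩

theorem mod_eq_of_modEq {x n : ℕ} {z : ℤ} (h : (x : ℤ) ≡ z [ZMOD n]) :
    x % n = (z % n).toNat % n := by
  rw [← h.eq, ← Int.natCast_mod, Int.toNat_natCast, Nat.mod_mod]

theorem not_exists_covering_dvd_27000 (r : ℕ → ℤ) :
    ¬ ∀ x : ℤ, ∃ n : ℕ, 6 ≤ n ∧ n ∣ 27000 ∧ x ≡ r n [ZMOD n] := by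
  intro h
  set t := 81 * r 8 - 80 * r 27 with ht
  obtain ⟨ε, hε, h6⟩ : ∃ ε : ℤ, ε * ε = 1 ∧ ε * (r 6 - t) % 6 < 4 := by
    by_cases h6 : (r 6 - t) % 6 < 4
    · exact ⟨1, by norm_num, by rwa [one_mul]⟩
    · exact ⟨-1, by norm_num, by omega⟩
  let ρ (n : ℕ) : ℕ := (ε * (r n - t) % n).toNat
  refine not_covered (ρ := ρ) ?_ ?_ ?_ (covered_of_forall_exists fun x ↦ ?_)
  · have : (8 : ℤ) ∣ ε * (r 8 - t) := Dvd.dvd.mul_left (by omega) _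
    simp [ρ, Int.emod_eq_zero_of_dvd this]
  · have : (27 : ℤ) ∣ ε * (r 27 - t) := Dvd.dvd.mul_left (by omega) _
    simp [ρ, Int.emod_eq_zero_of_dvd this]
  · simp only [ρ, Nat.cast_ofNat]
    omega
  · obtain ⟨n, hn6, hn, hx⟩ := h (t + ε * x)
    refine ⟨n, hn6, hn, mod_eq_of_modEq ?_⟩
    have h1 := (hx.sub_right t).mul_left ε
    rwa [add_sub_cancel_left, ← mul_assoc, hε, one_mul] at h1

/-- The densities of the moduli of a covering system add up to at least `1`. -/
theorem le_sum_div_of_covering {S : Finset ℕ} {r : ℕ → ℤ} {N : ℕ}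
    (hcov : ∀ x : ℤ, ∃ n ∈ S, x ≡ r n [ZMOD (n : ℤ)]) (hN : ∀ n ∈ S, n ∣ N) :
    N ≤ ∑ n ∈ S, N / n := by
  have hsub : range N ⊆ S.biUnion fun n ↦ {x ∈ range N | x % n = (r n % n).toNat % n} :=
    fun x hx ↦ by
      obtain ⟨n, hn, hxn⟩ := hcov x
      exact mem_biUnion.2 ⟨n, hn, mem_filter.2 ⟨hx, mod_eq_of_modEq hxn⟩⟩
  calc N = #(range N) := (card_range N).symm
    _ ≤ _ := card_le_card hsub
    _ ≤ _ := card_biUnion_le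
    _ ≤ _ := sum_le_sum fun n hn ↦ card_class_le_div subset_rfl (hN n hn) _

/-- The divisors of `2 ^ k * 60` that are at least `6` have reciprocal sum less than `1`. -/
theorem sum_div_lt {S : Finset ℕ} {k : ℕ} (hmin : ∀ n ∈ S, 6 ≤ n)
    (hS : ∀ n ∈ S, n ∣ 2 ^ k * 60) : ∑ n ∈ S, 2 ^ k * 60 / n < 2 ^ k * 60 := by
  have hN : 2 ^ k * 60 ≠ 0 := by positivity
  have hσ : ∑ n ∈ (2 ^ k * 60).divisors, 2 ^ k * 60 / n = (2 ^ (k + 3) - 1) * 24 := by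
    refine (Nat.sum_div_divisors (2 ^ k * 60) id).trans ?_
    have h : ArithmeticFunction.sigma 1 (2 ^ k * 60) = (2 ^ (k + 3) - 1) * 24 := by
      rw [show 2 ^ k * 60 = 2 ^ (k + 2) * 15 by ring,
        ArithmeticFunction.isMultiplicative_sigma.map_mul_of_coprime
          (Nat.Coprime.pow_left _ (by norm_num)),
        ArithmeticFunction.sigma_one_apply_prime_pow Nat.prime_two, Nat.geomSum_eq le_rfl]
      rw [show ArithmeticFunction.sigma 1 15 = 24 by decide +kernel]
      simp
    rw [← h, ArithmeticFunction.sigma_one_apply]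
    rfl
  have hdisj : Disjoint S (Icc 1 5) := disjoint_left.2 fun n hn hn' ↦ by
    have := hmin n hn
    have := (mem_Icc.1 hn').2
    omega
  have hsub : S ∪ Icc 1 5 ⊆ (2 ^ k * 60).divisors := union_subset
    (fun n hn ↦ Nat.mem_divisors.2 ⟨hS n hn, hN⟩) fun n hn ↦ by
      refine Nat.mem_divisors.2 ⟨Dvd.dvd.mul_left ?_ _, hN⟩
      obtain ⟨h1, h5⟩ := mem_Icc.1 hn
      interval_cases n <;> norm_num
  have h := sum_le_sum_of_subset hsub (f := fun n ↦ 2 ^ k * 60 / n)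
  rw [sum_union hdisj, hσ, show Icc 1 5 = ({1, 2, 3, 4, 5} : Finset ℕ) from rfl] at h
  simp only [mem_insert, mem_singleton, not_false_eq_true, sum_insert, sum_singleton,
    Nat.reduceEqDiff, or_self] at h
  have := Nat.two_pow_pos k
  rw [pow_add] at h
  omega

/-- If C is a distinct covering system with least modulus 6 whose moduli have lcm 2^a * 3^b * 5^c with a ≥ b ≥ c ≥ 1, then a ≥ 4 and b ≥ 2. -/
theorem m6_implies_a_ge_four_b_ge_two (S : Finset ℕ) (r : ℕ → ℤ) (a b c : ℕ)
    (hmod : ∀ n ∈ S, 1 < n)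
    (hcov : ∀ x : ℤ, ∃ n ∈ S, x ≡ r n [ZMOD (n : ℤ)])
    (hm : 6 ∈ S) (hmin : ∀ n ∈ S, 6 ≤ n)
    (hlcm : S.lcm id = 2 ^ a * 3 ^ b * 5 ^ c)
    (ha : 1 ≤ a) (hb : 1 ≤ b) (hc : 1 ≤ c) (hab : b ≤ a) (hbc : c ≤ b) :
    4 ≤ a ∧ 2 ≤ b := by
  have hdvd (n : ℕ) (hn : n ∈ S) : n ∣ 2 ^ a * 3 ^ b * 5 ^ c := hlcm ▸ dvd_lcm (f := id) hn
  constructor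
  · by_contra! ha4
    refine not_exists_covering_dvd_27000 r fun x ↦ ?_
    obtain ⟨n, hn, hx⟩ := hcov x
    refine ⟨n, hmin n hn, (hdvd n hn).trans ?_, hx⟩
    rw [show 27000 = 2 ^ 3 * 3 ^ 3 * 5 ^ 3 by norm_num]
    exact mul_dvd_mul (mul_dvd_mul (pow_dvd_pow _ (by omega)) (pow_dvd_pow _ (by omega)))
      (pow_dvd_pow _ (by omega))
  · by_contra! hb2
    obtain rfl : b = 1 := by omega
    obtain rfl : c = 1 := by omega
    have hS (n : ℕ) (hn : n ∈ S) : n ∣ 2 ^ a * 60 := (hdvd n hn).trans ⟨4, by ring⟩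
    exact (le_sum_div_of_covering hcov hS).not_gt (sum_div_lt hmin hS)
end

section
/- There exists a distinct covering system with least modulus 6 whose moduli have least common multiple equal to 2^4·3^3·5^2 = 10800 and which contains no congruence with modulus 180 and none with modulus 900. -/
/-- Pairs `(n, r)` standing for the congruences `x ≡ r (mod n)` of the covering system. In groups:
the moduli prime to `5`, those exactly divisible by `5`, and those divisible by `25`. -/
def coveringCongruences : List (ℕ × ℕ) :=
  [(6, 0), (8, 7), (9, 1), (12, 9), (16, 11), (18, 4), (24, 17), (27, 25), (36, 13), (48, 3),
    (54, 16), (72, 67), (108, 97), (144, 115), (216, 169), (432, 277),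
    (10, 0), (15, 11), (20, 8), (30, 2), (40, 13), (45, 2), (60, 38), (80, 3), (90, 17), (120, 5),
    (135, 7), (240, 35), (270, 196), (360, 77), (540, 358), (720, 707), (1080, 61), (2160, 925),
    (25, 24), (50, 4), (75, 59), (100, 44), (150, 14), (200, 69), (225, 164), (300, 194),
    (400, 19), (450, 89), (600, 29), (675, 439), (1200, 179), (1350, 34), (1800, 1589),
    (2700, 2194), (3600, 1139), (5400, 709), (10800, 10429)]

/-- The residue attached to the modulus `n`. -/
def coveringResidue (n : ℕ) : ℕ := (coveringCongruences.lookup n).getD 0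

/-- The set of moduli of the covering system. -/
def coveringModuli : Finset ℕ := (coveringCongruences.map Prod.fst).toFinset

theorem coveringResidue_fst :
    ∀ p ∈ coveringCongruences, coveringResidue p.1 = p.2 := by decide +kernel

theorem coveringModuli_dvd : ∀ n ∈ coveringModuli, n ∣ 10800 := by decide +kernel

theorem covers_of_lt_aux : ∀ a < 108, ∀ b < 100,
    (coveringCongruences.any fun p => (100 * a + b) % p.1 == p.2) = true := by
  decide +kernel

/-- Every natural number below the common multiple `10800` satisfies one of the congruences. -/
theorem covers_of_lt {x : ℕ} (hx : x < 10800) :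
    ∃ n ∈ coveringModuli, x % n = coveringResidue n := by
  have h := covers_of_lt_aux (x / 100) (by omega) (x % 100) (by omega)
  rw [Nat.div_add_mod, List.any_eq_true] at h
  obtain ⟨p, hp, hxp⟩ := h
  exact ⟨p.1, List.mem_toFinset.2 (List.mem_map_of_mem hp),
    (beq_iff_eq.1 hxp).trans (coveringResidue_fst p hp).symm⟩

theorem covers (x : ℤ) : ∃ n ∈ coveringModuli, x ≡ (coveringResidue n : ℤ) [ZMOD (n : ℤ)] := by
  obtain ⟨y, hy⟩ := Int.eq_ofNat_of_zero_le (Int.emod_nonneg x (b := 10800) (by norm_num))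
  obtain ⟨n, hn, h⟩ := covers_of_lt (x := y) (by omega)
  refine ⟨n, hn, ?_⟩
  have hxy : x ≡ (y : ℤ) [ZMOD (n : ℤ)] := by
    rw [← hy]
    exact (Int.mod_modEq x 10800).symm.of_dvd (by exact_mod_cast coveringModuli_dvd n hn)
  have hyn : y ≡ coveringResidue n [MOD n] := h ▸ (Nat.mod_modEq y n).symm
  exact hxy.trans (Int.natCast_modEq_iff.2 hyn)


/-- There exists a distinct covering system with least modulus 6, lcm of moduli 2^4 * 3^3 * 5^2 = 10800, containing no congruence with modulus 180 and none with modulus 900. -/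
theorem exists_covering_m6_L10800_no180_no900 :
    ∃ (S : Finset ℕ) (r : ℕ → ℤ),
      (∀ n ∈ S, 1 < n) ∧
      (∀ x : ℤ, ∃ n ∈ S, x ≡ r n [ZMOD (n : ℤ)]) ∧
      (6 ∈ S ∧ ∀ n ∈ S, 6 ≤ n) ∧
      S.lcm id = 2 ^ 4 * 3 ^ 3 * 5 ^ 2 ∧
      180 ∉ S ∧ 900 ∉ S := by
  refine ⟨coveringModuli, fun n => coveringResidue n, ?_, covers, ?_, ?_, ?_, ?_⟩
  all_goals decide +kernel
end

section
/- There exists a distinct covering system with least modulus 6 whose moduli have least common multiple equal to 2^5·3^4·5 = 12960 and in which no modulus is a multiple of 405. -/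
/-- Whether the residue class of `a` modulo `m` is covered by the congruences, given as pairs
`(modulus, residue)`, in a list of levels. Each level `(q, ps)` splits a class modulo `m` into `q`
classes modulo `q * m`, of which those contained in a congruence from `ps` are discarded. -/
def coversClass : List (ℕ × List (ℕ × ℕ)) → ℕ → ℕ → Bool
  | [], _, _ => false
  | (q, ps) :: ls, m, a => !Nat.beq q 0 && (List.range q).all fun i =>
      (ps.any fun p => Nat.beq (q * m % p.1) 0 && Nat.beq ((a + i * m) % p.1) p.2) ||
        coversClass ls (q * m) (a + i * m)

theorem exists_modEq_of_coversClass (ls : List (ℕ × List (ℕ × ℕ))) (m a : ℕ)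
    (h : coversClass ls m a = true) (x : ℤ) (hx : x ≡ a [ZMOD m]) :
    ∃ p ∈ ls.flatMap Prod.snd, x ≡ (p.2 : ℤ) [ZMOD (p.1 : ℤ)] := by
  induction ls generalizing m a with
  | nil => simp [coversClass] at h
  | cons l ls ih =>
    obtain ⟨q, ps⟩ := l
    simp only [coversClass, Bool.and_eq_true, Bool.not_eq_true', List.all_eq_true, List.mem_range,
      Bool.or_eq_true, List.any_eq_true] at h
    obtain ⟨hq, h⟩ := h
    replace hq : q ≠ 0 := by rintro rfl; simp at hq
    obtain ⟨t, ht⟩ := hx.symm.dvd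
    have hq' : (q : ℤ) ≠ 0 := by exact_mod_cast hq
    obtain ⟨i, hi⟩ := Int.eq_ofNat_of_zero_le (Int.emod_nonneg t hq')
    have hiq : i < q := by
      have := Int.emod_lt_of_pos t (by omega : (0 : ℤ) < q)
      omega
    have hxi : x ≡ ((a + i * m : ℕ) : ℤ) [ZMOD ((q * m : ℕ) : ℤ)] := by
      refine (Int.modEq_iff_dvd.2 ⟨t / q, ?_⟩).symm
      have := Int.mul_ediv_add_emod t q
      push_cast
      rw [hi] at this
      linear_combination ht - (m : ℤ) * this
    rcases h i hiq with ⟨p, hp, hdvd, hmod⟩ | h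
    · refine ⟨p, by simp only [List.flatMap_cons, List.mem_append]; exact Or.inl hp, ?_⟩
      refine (hxi.of_dvd (Int.natCast_dvd_natCast.2
        (Nat.dvd_of_mod_eq_zero (Nat.eq_of_beq_eq_true hdvd)))).trans ?_
      rw [← Nat.eq_of_beq_eq_true hmod, Int.natCast_mod]
      exact (Int.mod_modEq _ _).symm
    · obtain ⟨p, hp, hxp⟩ := ih _ _ h hxi
      exact ⟨p, by simp only [List.flatMap_cons, List.mem_append]; exact Or.inr hp, hxp⟩

/-- The congruences of the covering, arranged in levels for `coversClass`. -/
def congruenceLevels : List (ℕ × List (ℕ × ℕ)) :=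
  [(6, [(6, 4)]),
   (5, [(10, 6), (15, 3), (30, 0)]),
   (2, [(12, 7), (20, 2), (60, 12)]),
   (2, [(8, 1), (24, 15), (40, 27), (120, 51)]),
   (3, [(9, 8), (18, 14), (36, 23), (45, 24), (72, 11), (90, 84),
      (180, 54), (360, 219)]),
   (2, [(16, 13), (48, 37), (80, 75), (144, 101), (240, 195), (720, 459)]),
   (3, [(27, 2), (54, 38), (108, 11), (135, 99), (216, 47), (270, 54),
      (432, 290), (540, 144), (1080, 8), (2160, 141)]),
   (2, [(32, 21), (96, 69), (160, 19), (288, 5), (480, 99), (864, 358),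
      (1440, 1357), (4320, 1821)]),
   (3, [(81, 20), (162, 128), (324, 236), (648, 398), (1296, 74), (2592, 525)])]

/-- The congruences of the covering, as pairs `(modulus, residue)`. -/
def congruencePairs : List (ℕ × ℕ) :=
  congruenceLevels.flatMap Prod.snd

theorem coversClass_congruenceLevels : coversClass congruenceLevels 1 0 = true := by
  decide +kernel

theorem congruencePairs_spec :
    ∀ p ∈ congruencePairs, 6 ≤ p.1 ∧ ¬ 405 ∣ p.1 ∧ congruencePairs.lookup p.1 = some p.2 := by
  decide +kernel

/-- There exists a distinct covering system with least modulus 6, lcm of moduli 2^5 * 3^4 * 5 = 12960, in which no modulus is a multiple of 405. -/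
theorem exists_covering_m6_L12960_no_mult405 :
    ∃ (S : Finset ℕ) (r : ℕ → ℤ),
      (∀ n ∈ S, 1 < n) ∧
      (∀ x : ℤ, ∃ n ∈ S, x ≡ r n [ZMOD (n : ℤ)]) ∧
      (6 ∈ S ∧ ∀ n ∈ S, 6 ≤ n) ∧
      S.lcm id = 2 ^ 5 * 3 ^ 4 * 5 ∧
      (∀ n ∈ S, ¬ 405 ∣ n) := by
  have hS : ∀ n ∈ (congruencePairs.map Prod.fst).toFinset, 6 ≤ n ∧ ¬ 405 ∣ n := by
    intro n hn
    obtain ⟨p, hp, rfl⟩ := List.mem_map.1 (List.mem_toFinset.1 hn)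
    exact ⟨(congruencePairs_spec p hp).1, (congruencePairs_spec p hp).2.1⟩
  refine ⟨(congruencePairs.map Prod.fst).toFinset,
    fun n => ((congruencePairs.lookup n).getD 0 : ℕ),
    fun n hn => lt_of_lt_of_le (by norm_num) (hS n hn).1, fun x => ?_,
    ⟨by decide +kernel, fun n hn => (hS n hn).1⟩, by decide +kernel, fun n hn => (hS n hn).2⟩
  obtain ⟨p, hp, hx⟩ :=
    exists_modEq_of_coversClass congruenceLevels 1 0 coversClass_congruenceLevels x
      (by simpa using Int.modEq_one)
  refine ⟨p.1, List.mem_toFinset.2 (List.mem_map_of_mem hp), ?_⟩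
  simpa [(congruencePairs_spec p hp).2.2] using hx
end
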